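/- Let 𝔅' ⊆ 𝔅(X) be nonempty with the forward exchange property. Then the linear map 𝒟(X,𝔅') → 𝒫(X,𝔅')^* sending f to the functional p ↦ ⟨p,f⟩ is an isomorphism; in particular dim 𝒟(X,𝔅') = dim 𝒫(X,𝔅') = |𝔅'|. -/

import Mathlib

noncomputable section

variable {r N : ℕ}

/-- `p_u`, the degree-one polynomial associated with the vector `u ∈ ℝ^r`. -/
def linPoly {r : ℕ} (u : Fin r → ℝ) : MvPolynomial (Fin r) ℝ :=
  ∑ i, MvPolynomial.C (u i) * MvPolynomial.X i

/-- `p_Y = ∏_{i ∈ Y} p_{X i}` for a sublist `Y` of the list `X`. -/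
def prodPoly {r N : ℕ} (X : Fin N → Fin r → ℝ) (Y : Finset (Fin N)) : MvPolynomial (Fin r) ℝ :=
  ∏ i ∈ Y, linPoly (X i)

/-- The pairing `⟨p, f⟩ = (p(∂/∂t₁,…,∂/∂t_r) f)(0)`, written via coefficients:
`⟨p,f⟩ = ∑_α α! · p_α · f_α`. -/
def pairing {r : ℕ} (p f : MvPolynomial (Fin r) ℝ) : ℝ :=
  ∑ α ∈ p.support, (∏ i, ((α i).factorial : ℝ)) * p.coeff α * f.coeff α

lemma pairing_zero {r : ℕ} (q : MvPolynomial (Fin r) ℝ) : pairing q 0 = 0 := by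
  simp [pairing]

lemma pairing_add {r : ℕ} (q f g : MvPolynomial (Fin r) ℝ) :
    pairing q (f + g) = pairing q f + pairing q g := by
  unfold pairing
  rw [← Finset.sum_add_distrib]
  exact Finset.sum_congr rfl fun α _ => by rw [MvPolynomial.coeff_add]; ring

lemma pairing_smul {r : ℕ} (q : MvPolynomial (Fin r) ℝ) (c : ℝ) (f : MvPolynomial (Fin r) ℝ) :
    pairing q (c • f) = c * pairing q f := by
  unfold pairing
  rw [Finset.mul_sum]
  exact Finset.sum_congr rfl fun α _ => by rw [MvPolynomial.coeff_smul, smul_eq_mul]; ring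

/-- The kernel (Macaulay inverse system) of an ideal `I`:
all polynomials annihilated (in the sense of the pairing) by every element of `I`. -/
def kerIdeal {r : ℕ} (I : Ideal (MvPolynomial (Fin r) ℝ)) :
    Submodule ℝ (MvPolynomial (Fin r) ℝ) where
  carrier := {f | ∀ q ∈ I, pairing q f = 0}
  add_mem' := fun hf hg q hq => by
    rw [pairing_add, hf q hq, hg q hq, add_zero]
  zero_mem' := fun q _ => pairing_zero q
  smul_mem' := fun c f hf q hq => by
    rw [pairing_smul, hf q hq, mul_zero]

section Lists

variable {M : Type*} [AddCommGroup M] [Module ℝ M]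

/-- `B ⊆ G` is (the index set of) a sublist of the list `v` restricted to the ground set `G`
that is a basis of the ambient space. -/
def basesOn (v : Fin N → M) (G : Finset (Fin N)) : Set (Finset (Fin N)) :=
  {B | B ⊆ G ∧ LinearIndependent ℝ ((B : Set (Fin N)).restrict v) ∧
    Submodule.span ℝ (v '' (B : Set (Fin N))) = ⊤}

/-- `j` is externally active with respect to the basis `B`:
`v j ∈ span {v e : e ∈ B, e ≤ j}` and `j ∉ B`. -/
def isExtActive (v : Fin N → M) (B : Finset (Fin N)) (j : Fin N) : Prop :=
  j ∉ B ∧ v j ∈ Submodule.span ℝ (v '' {e : Fin N | e ∈ B ∧ e ≤ j})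

open Classical in
/-- The set `E(B)` of externally active elements (within the ground set `G`). -/
def extSetOn (v : Fin N → M) (G B : Finset (Fin N)) : Finset (Fin N) :=
  G.filter (fun j => isExtActive v B j)

/-- `C` is a cocircuit w.r.t. the collection of bases `𝔅`: an inclusion-minimal
sublist of the ground set `G` intersecting every basis in `𝔅`. -/
def isCocircuitOn (G : Finset (Fin N)) (𝔅 : Set (Finset (Fin N))) (C : Finset (Fin N)) : Prop :=
  C ⊆ G ∧ (∀ B ∈ 𝔅, (C ∩ B).Nonempty) ∧
    ∀ C' ⊆ C, (∀ B ∈ 𝔅, (C' ∩ B).Nonempty) → C' = C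

/-- A set of bases `𝔅` of the list `v` has the forward exchange property. -/
def forwardExchange (v : Fin N → M) (𝔅 : Set (Finset (Fin N))) : Prop :=
  ∀ B ∈ 𝔅, ∀ b ∈ B, ∀ j : Fin N,
    v j ∈ Submodule.span ℝ (v '' {e : Fin N | e ∈ B ∧ e ≤ b}) →
    v j ∉ Submodule.span ℝ (v '' {e : Fin N | e ∈ B ∧ e < b}) →
    ¬ isExtActive v B j →
    insert j (B.erase b) ∈ 𝔅

end Lists

/-- The ideal `𝒥` generated by the cocircuit polynomials `p_C`. -/
def Jideal (X : Fin N → Fin r → ℝ) (G : Finset (Fin N)) (𝔅 : Set (Finset (Fin N))) :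
    Ideal (MvPolynomial (Fin r) ℝ) :=
  Ideal.span {p | ∃ C : Finset (Fin N), isCocircuitOn G 𝔅 C ∧ p = prodPoly X C}

/-- The generalised `𝒟`-space: the kernel of the cocircuit ideal. -/
def Dspace (X : Fin N → Fin r → ℝ) (G : Finset (Fin N)) (𝔅 : Set (Finset (Fin N))) :
    Submodule ℝ (MvPolynomial (Fin r) ℝ) :=
  kerIdeal (Jideal X G 𝔅)

/-- `Q_B := p_{X∖(B ∪ E(B))}` (within the ground set `G`). -/
def QB (X : Fin N → Fin r → ℝ) (G B : Finset (Fin N)) : MvPolynomial (Fin r) ℝ :=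
  prodPoly X (G \ (B ∪ extSetOn X G B))

/-- The central `𝒫`-space: the span of `p_Y` over sublists `Y` of `G` whose complement spans. -/
def PspaceOn (X : Fin N → Fin r → ℝ) (G : Finset (Fin N)) :
    Submodule ℝ (MvPolynomial (Fin r) ℝ) :=
  Submodule.span ℝ {p | ∃ Y : Finset (Fin N), Y ⊆ G ∧
    Submodule.span ℝ (X '' ((G \ Y : Finset (Fin N)) : Set (Fin N))) = ⊤ ∧ p = prodPoly X Y}

/-- The generalised `𝒫`-space `𝒫(X,𝔅') = span {Q_B : B ∈ 𝔅'}`. -/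
def PspaceB (X : Fin N → Fin r → ℝ) (G : Finset (Fin N)) (𝔅 : Set (Finset (Fin N))) :
    Submodule ℝ (MvPolynomial (Fin r) ℝ) :=
  Submodule.span ℝ {p | ∃ B ∈ 𝔅, p = QB X G B}

/-- The directional derivative `D_u = ∑ i, uᵢ ∂/∂tᵢ` as a linear map. -/
def dirDeriv {r : ℕ} (u : Fin r → ℝ) :
    MvPolynomial (Fin r) ℝ →ₗ[ℝ] MvPolynomial (Fin r) ℝ :=
  ∑ i, u i • (MvPolynomial.pderiv i).toLinearMap

end

section ForwardExchange

variable {M : Type*} [AddCommGroup M] [Module ℝ M] {N : ℕ} {v : Fin N → M}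

/-- If `x` is neither in the basis `B` nor externally active, the forward exchange property replaces
a later element of `B` by `x`. -/
lemma forwardExchange.exists_exchange {𝔅 : Set (Finset (Fin N))} (hfe : forwardExchange v 𝔅)
    {B : Finset (Fin N)} (hB : B ∈ 𝔅)
    (hspan : Submodule.span ℝ (v '' (B : Set (Fin N))) = ⊤) {x : Fin N} (hx : x ∉ B)
    (hact : ¬ isExtActive v B x) :
    ∃ b ∈ B, x < b ∧ insert x (B.erase b) ∈ 𝔅 := by
  classical
  have hact' : v x ∉ Submodule.span ℝ (v '' {e : Fin N | e ∈ B ∧ e ≤ x}) :=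
    fun h => hact ⟨hx, h⟩
  let P : ℕ → Prop := fun k => v x ∈ Submodule.span ℝ (v '' {e : Fin N | e ∈ B ∧ (e : ℕ) < k})
  have hP : ∃ k, P k := by
    refine ⟨N, ?_⟩
    have : {e : Fin N | e ∈ B ∧ (e : ℕ) < N} = (B : Set (Fin N)) := by
      ext e; simp
    simp [P, hspan]
  have hmin : ∀ k, k < Nat.find hP → ¬ P k := fun k hk => Nat.find_min hP hk
  have hfind : P (Nat.find hP) := Nat.find_spec hP
  generalize Nat.find hP = k at hmin hfind
  rcases k with _ | k
  · exact absurd (Submodule.span_mono (Set.image_mono (by intro e he; simp at he)) hfind) hact'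
  have hk : ¬ P k := hmin k k.lt_succ_self
  obtain ⟨b, hbB, hbk⟩ : ∃ b ∈ B, (b : ℕ) = k := by
    by_contra! hcon
    refine hk ?_
    have : {e : Fin N | e ∈ B ∧ (e : ℕ) < k + 1} = {e : Fin N | e ∈ B ∧ (e : ℕ) < k} := by
      ext e
      simp only [Set.mem_ofPred_eq, and_congr_right_iff]
      intro he
      have := hcon e he
      omega
    simpa only [P, this] using hfind
  subst hbk
  have hle : v x ∈ Submodule.span ℝ (v '' {e : Fin N | e ∈ B ∧ e ≤ b}) := by
    refine Submodule.span_mono (Set.image_mono ?_) hfind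
    rintro e ⟨he, hlt⟩
    exact ⟨he, Fin.le_def.2 (by omega)⟩
  refine ⟨b, hbB, ?_, hfe B hB b hbB x hle hk hact⟩
  by_contra hbx
  refine hact' (Submodule.span_mono (Set.image_mono ?_) hle)
  rintro e ⟨he, heb⟩
  exact ⟨he, heb.trans (not_lt.1 hbx)⟩

/-- If `Y` misses some basis in `𝔅`, then it misses a basis in `𝔅` for which every element outside
`Y` is a member or externally active. -/
lemma forwardExchange.exists_greedy {𝔅 : Set (Finset (Fin N))} (hfe : forwardExchange v 𝔅)
    (hsub : 𝔅 ⊆ basesOn v Finset.univ) {Y : Finset (Fin N)}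
    (hY : ∃ B ∈ 𝔅, ¬ (Y ∩ B).Nonempty) :
    ∃ B ∈ 𝔅, Disjoint Y B ∧ Finset.univ \ (B ∪ extSetOn v Finset.univ B) ⊆ Y := by
  classical
  obtain ⟨B₀, hB₀, hYB₀⟩ := hY
  let T : Finset (Finset (Fin N)) := Finset.univ.filter fun B => B ∈ 𝔅 ∧ Disjoint Y B
  have hT : T.Nonempty := ⟨B₀, by
    simpa [T, hB₀, Finset.disjoint_iff_inter_eq_empty, Finset.not_nonempty_iff_eq_empty]
      using hYB₀⟩
  obtain ⟨B, hBT, hBmin⟩ := Finset.exists_min_image T (fun B => ∑ b ∈ B, (b : ℕ)) hT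
  obtain ⟨hB, hYB⟩ : B ∈ 𝔅 ∧ Disjoint Y B := by simpa [T] using hBT
  refine ⟨B, hB, hYB, fun x hx => ?_⟩
  simp only [extSetOn, Finset.mem_sdiff, Finset.mem_univ, true_and, Finset.mem_union,
    Finset.mem_filter, not_or] at hx
  by_contra hxY
  obtain ⟨b, hbB, hxb, hnew⟩ := hfe.exists_exchange hB (hsub hB).2.2 hx.1 hx.2
  have hmem : insert x (B.erase b) ∈ T := by
    simp only [T, Finset.mem_filter, Finset.mem_univ, true_and]
    refine ⟨hnew, Finset.disjoint_insert_right.2 ⟨hxY, ?_⟩⟩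
    exact Finset.disjoint_of_subset_right (Finset.erase_subset _ _) hYB
  have hle := hBmin _ hmem
  rw [Finset.sum_insert (by simp [hx.1]), ← Finset.add_sum_erase B _ hbB] at hle
  have : (x : ℕ) < b := hxb
  omega

variable {A : Type*} [CommRing A] [Algebra ℝ A] (L : M →ₗ[ℝ] A) (κ : Fin N → A)

/-- Products of the affine forms `L (v i) - κ i` lie in any filtration that contains the products
attached to the bases in `𝔅` and the products over sublists meeting all bases in `𝔅`. -/
lemma forwardExchange.prod_mem {𝔅 : Set (Finset (Fin N))} (hfe : forwardExchange v 𝔅)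
    (hsub : 𝔅 ⊆ basesOn v Finset.univ) (W : ℕ → Submodule ℝ A)
    (hbasis : ∀ B ∈ 𝔅, ∏ i ∈ Finset.univ \ (B ∪ extSetOn v Finset.univ B), (L (v i) - κ i) ∈
      W (Finset.univ \ (B ∪ extSetOn v Finset.univ B)).card)
    (hmeet : ∀ Y : Finset (Fin N), (∀ B ∈ 𝔅, (Y ∩ B).Nonempty) →
      ∏ i ∈ Y, (L (v i) - κ i) ∈ W Y.card)
    (hκ : ∀ d i, ∀ w ∈ W d, κ i * w ∈ W (d + 1)) (Y : Finset (Fin N)) :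
    ∏ i ∈ Y, (L (v i) - κ i) ∈ W Y.card := by
  classical
  induction hm : ∑ i ∈ Y, ((i : ℕ) + 1) using Nat.strong_induction_on generalizing Y with
  | _ m ih =>
  by_cases hY : ∀ B ∈ 𝔅, (Y ∩ B).Nonempty
  · exact hmeet Y hY
  push Not at hY
  obtain ⟨B, hB, hYB, hsubY⟩ := hfe.exists_greedy hsub (Y := Y) (by
    obtain ⟨B, hB, h⟩ := hY
    exact ⟨B, hB, by simpa [Finset.not_nonempty_iff_eq_empty] using h⟩)
  rcases eq_or_ne (Finset.univ \ (B ∪ extSetOn v Finset.univ B)) Y with heq | hneq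
  · exact heq ▸ hbasis B hB
  obtain ⟨x, hxY, hx⟩ : ∃ x ∈ Y, x ∉ Finset.univ \ (B ∪ extSetOn v Finset.univ B) := by
    by_contra! hcon
    exact hneq (hsubY.antisymm hcon)
  have hxB : x ∉ B := Finset.disjoint_left.1 hYB hxY
  have hxact : v x ∈ Submodule.span ℝ (v '' {e : Fin N | e ∈ B ∧ e ≤ x}) := by
    simp only [extSetOn, Finset.mem_sdiff, Finset.mem_univ, true_and, Finset.mem_union,
      Finset.mem_filter, not_not] at hx
    exact (hx.resolve_left hxB).2
  have hcard : (Y.erase x).card + 1 = Y.card := Finset.card_erase_add_one hxY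
  have hsum := Finset.add_sum_erase Y (fun i : Fin N => (i : ℕ) + 1) hxY
  have herase := ih _ (by omega) (Y.erase x) rfl
  have key : ∀ u ∈ Submodule.span ℝ (v '' {e : Fin N | e ∈ B ∧ e ≤ x}),
      L u * ∏ i ∈ Y.erase x, (L (v i) - κ i) ∈ W Y.card := by
    intro u hu
    induction hu using Submodule.span_induction with
    | mem u hu =>
      obtain ⟨e, ⟨heB, hex⟩, rfl⟩ := hu
      have hlt : (e : ℕ) < x := lt_of_le_of_ne hex fun h => hxB (Fin.ext h ▸ heB)
      have heY : e ∉ Y.erase x := fun h =>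
        Finset.disjoint_left.1 hYB (Finset.mem_of_mem_erase h) heB
      have h₁ := ih (∑ i ∈ insert e (Y.erase x), ((i : ℕ) + 1))
        (by rw [Finset.sum_insert heY]; omega) (insert e (Y.erase x)) rfl
      rw [Finset.prod_insert heY, Finset.card_insert_of_notMem heY, hcard] at h₁
      have h₂ := hκ _ e _ herase
      rw [hcard] at h₂
      convert add_mem h₁ h₂ using 1
      ring
    | zero => simp
    | add u w _ _ hu hw => rw [map_add, add_mul]; exact add_mem hu hw
    | smul c u _ hu => rw [map_smul, smul_mul_assoc]; exact Submodule.smul_mem _ _ hu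
  have hκx := hκ _ x _ herase
  rw [hcard] at hκx
  rw [← Finset.mul_prod_erase Y _ hxY, sub_mul]
  exact sub_mem (key _ hxact) hκx

/-- In the situation of `forwardExchange.prod_mem`, multiplying the product attached to a basis by
a linear form raises the filtration degree by one. -/
lemma forwardExchange.mul_prod_mem {𝔅 : Set (Finset (Fin N))} (hfe : forwardExchange v 𝔅)
    (hsub : 𝔅 ⊆ basesOn v Finset.univ) (W : ℕ → Submodule ℝ A)
    (hbasis : ∀ B ∈ 𝔅, ∏ i ∈ Finset.univ \ (B ∪ extSetOn v Finset.univ B), (L (v i) - κ i) ∈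
      W (Finset.univ \ (B ∪ extSetOn v Finset.univ B)).card)
    (hmeet : ∀ Y : Finset (Fin N), (∀ B ∈ 𝔅, (Y ∩ B).Nonempty) →
      ∏ i ∈ Y, (L (v i) - κ i) ∈ W Y.card)
    (hκ : ∀ d i, ∀ w ∈ W d, κ i * w ∈ W (d + 1)) {B : Finset (Fin N)} (hB : B ∈ 𝔅) (u : M) :
    L u * ∏ i ∈ Finset.univ \ (B ∪ extSetOn v Finset.univ B), (L (v i) - κ i) ∈
      W ((Finset.univ \ (B ∪ extSetOn v Finset.univ B)).card + 1) := by
  classical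
  have hu : u ∈ Submodule.span ℝ (v '' (B : Set (Fin N))) := by
    rw [(hsub hB).2.2]; trivial
  induction hu using Submodule.span_induction with
  | mem u hu =>
    obtain ⟨b, hbB, rfl⟩ := hu
    have hb : b ∉ Finset.univ \ (B ∪ extSetOn v Finset.univ B) := by
      simp [Finset.mem_coe.1 hbB]
    have h₁ := hfe.prod_mem L κ hsub W hbasis hmeet hκ
      (insert b (Finset.univ \ (B ∪ extSetOn v Finset.univ B)))
    rw [Finset.prod_insert hb, Finset.card_insert_of_notMem hb] at h₁
    convert add_mem h₁ (hκ _ b _ (hbasis B hB)) using 1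
    ring
  | zero => simp
  | add u w _ _ hu hw => rw [map_add, add_mul]; exact add_mem hu hw
  | smul c u _ hu => rw [map_smul, smul_mul_assoc]; exact Submodule.smul_mem _ _ hu

end ForwardExchange

/-- A set meeting every basis in `𝔅` contains a cocircuit. -/
lemma exists_isCocircuitOn_subset {N : ℕ} {𝔅 : Set (Finset (Fin N))} {Y : Finset (Fin N)}
    (hY : ∀ B ∈ 𝔅, (Y ∩ B).Nonempty) : ∃ C ⊆ Y, isCocircuitOn Finset.univ 𝔅 C := by
  obtain ⟨C, hCY, hC⟩ := exists_minimal_le_of_wellFoundedLT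
    (fun C : Finset (Fin N) => ∀ B ∈ 𝔅, (C ∩ B).Nonempty) Y hY
  exact ⟨C, hCY, Finset.subset_univ _, hC.prop, fun C' hC' h => hC'.antisymm (hC.le_of_le h hC')⟩

/-- Square systems over a domain whose span contains a nonzero multiple of each coordinate vector
are linearly independent. -/
lemma linearIndependent_of_single_mem_span {K ι : Type*} [CommRing K] [IsDomain K] [Fintype ι]
    [DecidableEq ι] {w : ι → ι → K} {δ : ι → K} (hδ : ∀ i, δ i ≠ 0)
    (h : ∀ i, Pi.single i (δ i) ∈ Submodule.span K (Set.range w)) : LinearIndependent K w := by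
  have h' : ∀ i, ∃ g : ι → K, ∑ j, g j • w j = Pi.single i (δ i) := fun i =>
    (Submodule.mem_span_range_iff_exists_fun K).1 (h i)
  choose G hG using h'
  have hmul : Matrix.of G * Matrix.of w = Matrix.diagonal δ := by
    ext i j
    have := congrFun (hG i) j
    simp only [Finset.sum_apply, Pi.smul_apply, smul_eq_mul] at this
    rw [Matrix.mul_apply]
    simp only [Matrix.of_apply, this, Matrix.diagonal_apply, Pi.single_apply, eq_comm]
  have hdet : (Matrix.of w).det ≠ 0 := by
    intro h0
    have := congrArg Matrix.det hmul
    rw [Matrix.det_mul, h0, mul_zero, Matrix.det_diagonal] at this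
    exact Finset.prod_ne_zero_iff.2 (fun i _ => hδ i) this.symm
  refine Fintype.linearIndependent_iff.2 fun g hg => congrFun
    (Matrix.eq_zero_of_vecMul_eq_zero hdet (v := g) ?_)
  rw [Matrix.vecMul_eq_sum]
  exact hg

section Polynomials

variable {r N : ℕ}

/-- `linPoly` as a linear map. -/
noncomputable def linPolyHom (r : ℕ) : (Fin r → ℝ) →ₗ[ℝ] MvPolynomial (Fin r) ℝ where
  toFun := linPoly
  map_add' u w := by simp [linPoly, add_mul, Finset.sum_add_distrib]
  map_smul' c u := by
    simp [linPoly, Finset.mul_sum, mul_assoc, MvPolynomial.smul_eq_C_mul]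

@[simp] lemma linPolyHom_apply (u : Fin r → ℝ) : linPolyHom r u = linPoly u := rfl

lemma linPoly_single (j : Fin r) : linPoly (Pi.single j 1) = MvPolynomial.X j := by
  simp [linPoly, Pi.single_apply]

/-- The degree-`d` part of `𝒫(X,𝔅)`, enlarged by the cocircuit ideal. -/
noncomputable def gradedSpace (X : Fin N → Fin r → ℝ) (𝔅 : Set (Finset (Fin N))) (d : ℕ) :
    Submodule ℝ (MvPolynomial (Fin r) ℝ) :=
  Submodule.span ℝ {p | ∃ B ∈ 𝔅, (Finset.univ \ (B ∪ extSetOn X Finset.univ B)).card = d ∧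
    p = QB X Finset.univ B} ⊔ (Jideal X Finset.univ 𝔅).restrictScalars ℝ

variable {X : Fin N → Fin r → ℝ} {𝔅 : Set (Finset (Fin N))}

lemma prodPoly_mem_Jideal {Y : Finset (Fin N)} (hY : ∀ B ∈ 𝔅, (Y ∩ B).Nonempty) :
    prodPoly X Y ∈ Jideal X Finset.univ 𝔅 := by
  obtain ⟨C, hCY, hC⟩ := exists_isCocircuitOn_subset hY
  exact Ideal.mem_of_dvd _ (Finset.prod_dvd_prod_of_subset _ _ _ hCY)
    (Ideal.subset_span ⟨C, hC, rfl⟩)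

lemma linPoly_mul_mem_gradedSpace (hsub : 𝔅 ⊆ basesOn X Finset.univ) (hfe : forwardExchange X 𝔅)
    {d : ℕ} {p : MvPolynomial (Fin r) ℝ} (hp : p ∈ gradedSpace X 𝔅 d) (u : Fin r → ℝ) :
    linPoly u * p ∈ gradedSpace X 𝔅 (d + 1) := by
  obtain ⟨p, hspan, q, hq, rfl⟩ := Submodule.mem_sup.1 hp
  clear hp
  rw [mul_add]
  refine add_mem ?_ (Submodule.mem_sup_right (Ideal.mul_mem_left _ _ hq))
  induction hspan using Submodule.span_induction with
  | mem p hp =>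
    obtain ⟨B, hB, rfl, rfl⟩ := hp
    have := hfe.mul_prod_mem (linPolyHom r) 0 hsub (gradedSpace X 𝔅) ?_ ?_ ?_ hB u
    · simpa [QB, prodPoly] using this
    · intro B hB
      refine Submodule.mem_sup_left (Submodule.subset_span ⟨B, hB, rfl, ?_⟩)
      simp [QB, prodPoly]
    · intro Y hY
      refine Submodule.mem_sup_right ?_
      simpa [prodPoly] using prodPoly_mem_Jideal (X := X) hY
    · simp
  | zero => simp
  | add p q _ _ hp hq => rw [mul_add]; exact add_mem hp hq
  | smul c p _ hp => rw [mul_smul_comm]; exact Submodule.smul_mem _ _ hp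

lemma one_mem_gradedSpace (hsub : 𝔅 ⊆ basesOn X Finset.univ) (hfe : forwardExchange X 𝔅) :
    (1 : MvPolynomial (Fin r) ℝ) ∈ gradedSpace X 𝔅 0 := by
  have := hfe.prod_mem (linPolyHom r) 0 hsub (gradedSpace X 𝔅) ?_ ?_ ?_ ∅
  · simpa using this
  · intro B hB
    refine Submodule.mem_sup_left (Submodule.subset_span ⟨B, hB, rfl, ?_⟩)
    simp [QB, prodPoly]
  · intro Y hY
    refine Submodule.mem_sup_right ?_
    simpa [prodPoly] using prodPoly_mem_Jideal (X := X) hY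
  · simp

lemma monomial_mem_gradedSpace (hsub : 𝔅 ⊆ basesOn X Finset.univ) (hfe : forwardExchange X 𝔅)
    (α : Fin r →₀ ℕ) : MvPolynomial.monomial α (1 : ℝ) ∈ gradedSpace X 𝔅 α.degree := by
  induction hd : α.degree generalizing α with
  | zero =>
    obtain rfl : α = 0 := (Finsupp.degree_eq_zero_iff α).1 hd
    simpa using one_mem_gradedSpace hsub hfe
  | succ d ih =>
    obtain ⟨j, hj⟩ : ∃ j, α j ≠ 0 := by
      by_contra! h
      simp [show α = 0 from Finsupp.ext h] at hd
    have hα : Finsupp.single j 1 + (α - Finsupp.single j 1) = α :=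
      add_tsub_cancel_of_le (Finsupp.single_le_iff.2 (Nat.one_le_iff_ne_zero.2 hj))
    have hdeg : (α - Finsupp.single j 1).degree = d := by
      have := congrArg Finsupp.degree hα
      rw [map_add, Finsupp.degree_single] at this
      omega
    have := linPoly_mul_mem_gradedSpace hsub hfe (ih _ hdeg) (Pi.single j 1)
    rwa [linPoly_single, MvPolynomial.X, MvPolynomial.monomial_mul, hα, one_mul] at this

/-- `𝒫(X,𝔅)` and the cocircuit ideal together span the polynomial ring. -/
lemma PspaceB_sup_Jideal (hsub : 𝔅 ⊆ basesOn X Finset.univ) (hfe : forwardExchange X 𝔅) :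
    PspaceB X Finset.univ 𝔅 ⊔ (Jideal X Finset.univ 𝔅).restrictScalars ℝ = ⊤ := by
  have hle : ∀ d, gradedSpace X 𝔅 d ≤
      PspaceB X Finset.univ 𝔅 ⊔ (Jideal X Finset.univ 𝔅).restrictScalars ℝ := fun d =>
    sup_le_sup_right (Submodule.span_mono (by
      rintro p ⟨B, hB, -, h⟩
      exact ⟨B, hB, h⟩)) _
  refine eq_top_iff.2 fun p _ => ?_
  rw [p.as_sum]
  refine sum_mem fun α _ => ?_
  rw [← mul_one (p.coeff α), ← smul_eq_mul, ← MvPolynomial.smul_monomial]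
  exact Submodule.smul_mem _ _ (hle _ (monomial_mem_gradedSpace hsub hfe α))

/-- Monomials of degree larger than `N` lie in the cocircuit ideal. -/
lemma monomial_mem_Jideal (hsub : 𝔅 ⊆ basesOn X Finset.univ) (hfe : forwardExchange X 𝔅)
    {α : Fin r →₀ ℕ} (hα : N < α.degree) :
    MvPolynomial.monomial α (1 : ℝ) ∈ Jideal X Finset.univ 𝔅 := by
  have hempty : {p | ∃ B ∈ 𝔅,
      (Finset.univ \ (B ∪ extSetOn X Finset.univ B)).card = α.degree ∧
      p = QB X Finset.univ B} = ∅ := by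
    refine Set.eq_empty_of_forall_notMem ?_
    rintro p ⟨B, _, hcard, _⟩
    have := Finset.card_le_univ (Finset.univ \ (B ∪ extSetOn X Finset.univ B))
    rw [Fintype.card_fin] at this
    omega
  simpa [gradedSpace, hempty] using monomial_mem_gradedSpace hsub hfe α

/-- The linear form `linPoly u` with coefficients in the polynomial ring in `N` parameters. -/
noncomputable def paramLinPoly (r N : ℕ) :
    (Fin r → ℝ) →ₗ[ℝ] MvPolynomial (Fin r) (MvPolynomial (Fin N) ℝ) :=
  (MvPolynomial.mapAlgHom (Algebra.ofId ℝ (MvPolynomial (Fin N) ℝ))).toLinearMap ∘ₗ linPolyHom r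

lemma paramLinPoly_single (j : Fin r) :
    paramLinPoly r N (Pi.single j 1) = MvPolynomial.X j := by
  simp [paramLinPoly, linPoly_single]

/-- The product over `Y` of the linear forms of `X`, each translated by its own parameter. -/
noncomputable def paramProd (X : Fin N → Fin r → ℝ) (Y : Finset (Fin N)) :
    MvPolynomial (Fin r) (MvPolynomial (Fin N) ℝ) :=
  ∏ i ∈ Y, (paramLinPoly r N (X i) - MvPolynomial.C (MvPolynomial.X i))

/-- The ideal generated by the translated cocircuit polynomials. -/
noncomputable def paramJideal (X : Fin N → Fin r → ℝ) (𝔅 : Set (Finset (Fin N))) :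
    Ideal (MvPolynomial (Fin r) (MvPolynomial (Fin N) ℝ)) :=
  Ideal.span (paramProd X '' {C | isCocircuitOn Finset.univ 𝔅 C})

lemma paramProd_mem_paramJideal {Y : Finset (Fin N)} (hY : ∀ B ∈ 𝔅, (Y ∩ B).Nonempty) :
    paramProd X Y ∈ paramJideal X 𝔅 := by
  obtain ⟨C, hCY, hC⟩ := exists_isCocircuitOn_subset hY
  exact Ideal.mem_of_dvd _ (Finset.prod_dvd_prod_of_subset _ _ _ hCY)
    (Ideal.subset_span ⟨C, hC, rfl⟩)

lemma map_constantCoeff_paramLinPoly (u : Fin r → ℝ) :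
    MvPolynomial.map MvPolynomial.constantCoeff (paramLinPoly r N u) = linPoly u := by
  simp [paramLinPoly, linPoly, MvPolynomial.algebraMap_eq]

lemma map_constantCoeff_paramProd (Y : Finset (Fin N)) :
    MvPolynomial.map MvPolynomial.constantCoeff (paramProd X Y) = prodPoly X Y := by
  simp [paramProd, prodPoly, map_constantCoeff_paramLinPoly]

lemma map_constantCoeff_paramJideal :
    (paramJideal X 𝔅).map (MvPolynomial.map MvPolynomial.constantCoeff) =
      Jideal X Finset.univ 𝔅 := by
  rw [paramJideal, Ideal.map_span, Jideal, Set.image_image]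
  congr 1
  ext p
  simp [map_constantCoeff_paramProd, eq_comm]

/-- The span of the translated `Q_B`, enlarged by the ideal of translated cocircuit
polynomials. -/
noncomputable def paramSpace (X : Fin N → Fin r → ℝ) (𝔅 : Set (Finset (Fin N))) :
    Submodule (MvPolynomial (Fin N) ℝ) (MvPolynomial (Fin r) (MvPolynomial (Fin N) ℝ)) :=
  Submodule.span _ (Set.range fun B : 𝔅 =>
    paramProd X (Finset.univ \ (B ∪ extSetOn X Finset.univ B))) ⊔
      (paramJideal X 𝔅).restrictScalars _

lemma paramSpace_eq_top (hsub : 𝔅 ⊆ basesOn X Finset.univ) (hfe : forwardExchange X 𝔅) :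
    paramSpace X 𝔅 = ⊤ := by
  let W : ℕ → Submodule ℝ (MvPolynomial (Fin r) (MvPolynomial (Fin N) ℝ)) :=
    fun _ => (paramSpace X 𝔅).restrictScalars ℝ
  have hbasis : ∀ B ∈ 𝔅, paramProd X (Finset.univ \ (B ∪ extSetOn X Finset.univ B)) ∈
      W (Finset.univ \ (B ∪ extSetOn X Finset.univ B)).card := fun B hB =>
    Submodule.mem_sup_left (Submodule.subset_span ⟨⟨B, hB⟩, rfl⟩)
  have hmeet : ∀ Y : Finset (Fin N), (∀ B ∈ 𝔅, (Y ∩ B).Nonempty) →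
      paramProd X Y ∈ W Y.card := fun Y hY =>
    Submodule.mem_sup_right (paramProd_mem_paramJideal hY)
  have hκ : ∀ d i, ∀ w ∈ W d, MvPolynomial.C (MvPolynomial.X i) * w ∈ W (d + 1) := by
    intro d i w hw
    rw [← MvPolynomial.smul_eq_C_mul]
    exact Submodule.smul_mem (paramSpace X 𝔅) _ hw
  have hone : (1 : MvPolynomial (Fin r) (MvPolynomial (Fin N) ℝ)) ∈ paramSpace X 𝔅 := by
    simpa [W] using hfe.prod_mem (paramLinPoly r N) _ hsub W hbasis hmeet hκ ∅
  have hX : ∀ p ∈ paramSpace X 𝔅, ∀ j, MvPolynomial.X j * p ∈ paramSpace X 𝔅 := by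
    intro p hp j
    obtain ⟨p, hspan, q, hq, rfl⟩ := Submodule.mem_sup.1 hp
    clear hp
    rw [mul_add]
    refine add_mem ?_ (Submodule.mem_sup_right (Ideal.mul_mem_left _ _ hq))
    induction hspan using Submodule.span_induction with
    | mem p hp =>
      obtain ⟨⟨B, hB⟩, rfl⟩ := hp
      rw [← paramLinPoly_single]
      exact hfe.mul_prod_mem (paramLinPoly r N) _ hsub W hbasis hmeet hκ hB _
    | zero => simp
    | add p q _ _ hp hq => rw [mul_add]; exact add_mem hp hq
    | smul c p _ hp => rw [mul_smul_comm]; exact Submodule.smul_mem _ _ hp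
  refine eq_top_iff.2 fun p _ => ?_
  induction p using MvPolynomial.induction_on with
  | C a =>
    rw [← mul_one (MvPolynomial.C a), ← MvPolynomial.smul_eq_C_mul]
    exact Submodule.smul_mem _ _ hone
  | add p q hp hq => exact add_mem (hp trivial) (hq trivial)
  | mul_X p j hp => rw [mul_comm]; exact hX p (hp trivial) j

lemma aeval_paramLinPoly (T : (Fin r → ℝ) →ₗ[ℝ] MvPolynomial (Fin N) ℝ) (u : Fin r → ℝ) :
    MvPolynomial.aeval (fun j => T (Pi.single j 1)) (paramLinPoly r N u) = T u := by
  have hu : u = ∑ j, u j • Pi.single j (1 : ℝ) := by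
    simpa using (Pi.basisFun ℝ (Fin r)).sum_repr u |>.symm
  conv_rhs => rw [hu, map_sum]
  simp [paramLinPoly, linPoly, MvPolynomial.algebraMap_eq, MvPolynomial.smul_eq_C_mul]

/-- The sublists in `basesOn` are bases. -/
lemma exists_basis_of_mem_basesOn {B : Finset (Fin N)} (hB : B ∈ basesOn X Finset.univ) :
    ∃ b : Module.Basis B ℝ (Fin r → ℝ), ∀ i, b i = X i := by
  obtain ⟨-, hli, hspan⟩ := hB
  refine ⟨Module.Basis.mk (v := fun i : B => X i) hli ?_, fun i => Module.Basis.mk_apply ..⟩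
  rw [← hspan, Set.image_eq_range]
  rfl

/-- A basis `B` determines a point at which a translated form vanishes exactly if it belongs to
`B`. -/
lemma exists_vertex {B : Finset (Fin N)} (hB : B ∈ basesOn X Finset.univ) :
    ∃ θ : Fin r → MvPolynomial (Fin N) ℝ, ∀ Y : Finset (Fin N),
      MvPolynomial.aeval θ (paramProd X Y) = 0 ↔ ¬ Disjoint Y B := by
  obtain ⟨b, hb⟩ := exists_basis_of_mem_basesOn hB
  let T : (Fin r → ℝ) →ₗ[ℝ] MvPolynomial (Fin N) ℝ :=
    b.constr ℝ fun i : B => MvPolynomial.X (i : Fin N)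
  have hT : ∀ i (hi : i ∈ B), T (X i) = MvPolynomial.X i := by
    intro i hi
    have := b.constr_basis ℝ (fun i : B => (MvPolynomial.X (i : Fin N) : MvPolynomial (Fin N) ℝ))
      ⟨i, hi⟩
    rwa [hb] at this
  have hT' : ∀ x, x ∉ B → T (X x) ≠ MvPolynomial.X x := by
    intro x hx h
    have hzero : MvPolynomial.lcoeff ℝ (Finsupp.single x 1) ∘ₗ T = 0 := by
      refine b.ext fun i => ?_
      have hix : (i : Fin N) ≠ x := fun h => hx (h ▸ i.2)
      simp [hb, hT i i.2, MvPolynomial.coeff_X, Finsupp.single_left_inj, hix]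
    have := LinearMap.congr_fun hzero (X x)
    simp [h] at this
  refine ⟨fun j => T (Pi.single j 1), fun Y => ?_⟩
  rw [paramProd, map_prod, Finset.prod_eq_zero_iff, Finset.not_disjoint_iff]
  refine exists_congr fun i => and_congr_right fun _ => ?_
  rw [map_sub, aeval_paramLinPoly, MvPolynomial.aeval_C, Algebra.algebraMap_self_apply,
    sub_eq_zero]
  exact ⟨fun h => by_contra fun hi => hT' i hi h, hT i⟩

/-- The polynomials `Q_B`, `B ∈ 𝔅`, are linearly independent modulo the cocircuit ideal. -/
lemma eq_zero_of_sum_smul_QB_mem_Jideal [Fintype 𝔅] (hsub : 𝔅 ⊆ basesOn X Finset.univ)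
    (hfe : forwardExchange X 𝔅) {a : 𝔅 → ℝ}
    (ha : ∑ B, a B • QB X Finset.univ B ∈ Jideal X Finset.univ 𝔅) : a = 0 := by
  classical
  choose θ hθ using fun B : 𝔅 => exists_vertex (hsub B.2)
  let Q : 𝔅 → MvPolynomial (Fin r) (MvPolynomial (Fin N) ℝ) := fun B =>
    paramProd X (Finset.univ \ (B ∪ extSetOn X Finset.univ B))
  let E : MvPolynomial (Fin r) (MvPolynomial (Fin N) ℝ) →ₗ[MvPolynomial (Fin N) ℝ]
      𝔅 → MvPolynomial (Fin N) ℝ :=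
    LinearMap.pi fun B => (MvPolynomial.aeval (θ B)).toLinearMap
  have hEapply : ∀ p B, E p B = MvPolynomial.aeval (θ B) p := fun _ _ => rfl
  have hEJ : ∀ p ∈ paramJideal X 𝔅, E p = 0 := by
    intro p hp
    ext1 B
    have : paramJideal X 𝔅 ≤ RingHom.ker (MvPolynomial.aeval (θ B)) := by
      refine Ideal.span_le.2 ?_
      rintro _ ⟨C, hC, rfl⟩
      refine (hθ B C).2 ?_
      rw [Finset.disjoint_iff_inter_eq_empty]
      exact (hC.2.1 B B.2).ne_empty
    exact this hp
  have hrange : Submodule.map E ⊤ ≤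
      Submodule.span (MvPolynomial (Fin N) ℝ) (Set.range fun B => E (Q B)) := by
    rw [← paramSpace_eq_top hsub hfe, paramSpace, Submodule.map_sup, Submodule.map_span,
      ← Set.range_comp]
    refine sup_le le_rfl ?_
    rintro _ ⟨p, hp, rfl⟩
    rw [hEJ p hp]
    exact zero_mem _
  have hcard : ∀ B : 𝔅, (B : Finset (Fin N)).card = r := by
    intro B
    obtain ⟨b, -⟩ := exists_basis_of_mem_basesOn (hsub B.2)
    simpa using (Module.finrank_eq_card_basis b).symm
  have hli : LinearIndependent (MvPolynomial (Fin N) ℝ) fun B => E (Q B) := by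
    refine linearIndependent_of_single_mem_span
      (δ := fun B => MvPolynomial.aeval (θ B) (paramProd X (B : Finset (Fin N))ᶜ)) ?_ ?_
    · intro B h
      exact (hθ B _).1 h disjoint_compl_left
    · intro B
      refine hrange ⟨paramProd X (B : Finset (Fin N))ᶜ, trivial, ?_⟩
      ext1 B'
      rw [hEapply]
      rcases eq_or_ne B' B with rfl | hne
      · simp
      · rw [Pi.single_eq_of_ne hne, hθ]
        intro hdisj
        have hle : (B' : Finset (Fin N)) ⊆ B := by
          simpa using (Finset.subset_compl_comm.1 (Finset.subset_compl_iff_disjoint_right.2 hdisj))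
        exact hne (Subtype.ext (Finset.eq_of_subset_of_card_le hle (by rw [hcard, hcard])))
  rw [← map_constantCoeff_paramJideal, Ideal.mem_map_iff_of_surjective _
    (MvPolynomial.map_surjective _
      (fun c => ⟨MvPolynomial.C c, MvPolynomial.constantCoeff_C _ c⟩))] at ha
  obtain ⟨q, hq, hqa⟩ := ha
  let m : Ideal (MvPolynomial (Fin N) ℝ) := RingHom.ker MvPolynomial.constantCoeff
  have hmem : ∑ B, (MvPolynomial.C (a B) : MvPolynomial (Fin N) ℝ) • Q B - q ∈
      m • (⊤ : Submodule (MvPolynomial (Fin N) ℝ)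
        (MvPolynomial (Fin r) (MvPolynomial (Fin N) ℝ))) := by
    rw [Ideal.smul_top_eq_map, Submodule.restrictScalars_mem, MvPolynomial.algebraMap_eq,
      ← MvPolynomial.ker_map, RingHom.mem_ker, map_sub, hqa, map_sum, sub_eq_zero]
    refine Finset.sum_congr rfl fun B _ => ?_
    simp [Q, QB, MvPolynomial.smul_eq_C_mul, map_constantCoeff_paramProd]
  have hEmem : ∑ B, (MvPolynomial.C (a B) : MvPolynomial (Fin N) ℝ) • E (Q B) ∈
      m • Submodule.span (MvPolynomial (Fin N) ℝ) (Set.range fun B => E (Q B)) := by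
    refine Submodule.smul_mono le_rfl hrange ?_
    rw [← Submodule.map_smul'']
    exact ⟨_, hmem, by simp [hEJ q hq]⟩
  obtain ⟨g, hgm, hg⟩ := (Submodule.mem_ideal_smul_span_iff_exists_sum _ _ _).1 hEmem
  rw [Finsupp.sum_fintype _ _ (by simp)] at hg
  ext B
  have hgB : g B = MvPolynomial.C (a B) := by
    have := Fintype.linearIndependent_iff.1 hli (fun B => g B - MvPolynomial.C (a B))
      (by simp only [sub_smul, Finset.sum_sub_distrib, hg, sub_self]) B
    exact sub_eq_zero.1 this
  have := RingHom.mem_ker.1 (hgm B)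
  simpa [hgB] using this

lemma pairing_eq_sum_support_right (p f : MvPolynomial (Fin r) ℝ) :
    pairing p f = ∑ α ∈ f.support, (∏ i, ((α i).factorial : ℝ)) * p.coeff α * f.coeff α := by
  classical
  have h₁ := Finset.sum_subset (Finset.subset_union_left (s₁ := p.support) (s₂ := f.support))
    (f := fun α => (∏ i, ((α i).factorial : ℝ)) * p.coeff α * f.coeff α)
    (fun α _ hα => by simp [MvPolynomial.notMem_support_iff.1 hα])
  have h₂ := Finset.sum_subset (Finset.subset_union_right (s₁ := p.support) (s₂ := f.support))
    (f := fun α => (∏ i, ((α i).factorial : ℝ)) * p.coeff α * f.coeff α)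
    (fun α _ hα => by simp [MvPolynomial.notMem_support_iff.1 hα])
  exact h₁.trans h₂.symm

/-- The pairing as a bilinear map; the polynomial acted upon comes first. -/
noncomputable def pairingHom (r : ℕ) :
    MvPolynomial (Fin r) ℝ →ₗ[ℝ] MvPolynomial (Fin r) ℝ →ₗ[ℝ] ℝ :=
  LinearMap.mk₂ ℝ (fun f p => pairing p f)
    (fun f g p => pairing_add p f g) (fun c f p => pairing_smul p c f)
    (fun f p q => by
      simp only [pairing_eq_sum_support_right, MvPolynomial.coeff_add, ← Finset.sum_add_distrib]
      exact Finset.sum_congr rfl fun α _ => by ring)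
    (fun c f p => by
      simp only [pairing_eq_sum_support_right, MvPolynomial.coeff_smul, smul_eq_mul,
        Finset.mul_sum]
      exact Finset.sum_congr rfl fun α _ => by ring)

@[simp] lemma pairingHom_apply (f p : MvPolynomial (Fin r) ℝ) :
    pairingHom r f p = pairing p f := rfl

lemma pairing_monomial_one (α : Fin r →₀ ℕ) (f : MvPolynomial (Fin r) ℝ) :
    pairing (MvPolynomial.monomial α 1) f = (∏ i, ((α i).factorial : ℝ)) * f.coeff α := by
  classical
  simp [pairing, MvPolynomial.support_monomial]

lemma prod_factorial_ne_zero (α : Fin r →₀ ℕ) : (∏ i, ((α i).factorial : ℝ)) ≠ 0 :=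
  Finset.prod_ne_zero_iff.2 fun i _ => Nat.cast_ne_zero.2 (α i).factorial_ne_zero

/-- A linear functional vanishing on all monomials of large degree is represented by a
polynomial. -/
lemma exists_pairing_eq {Φ : MvPolynomial (Fin r) ℝ →ₗ[ℝ] ℝ} {n : ℕ}
    (hΦ : ∀ α : Fin r →₀ ℕ, n < α.degree → Φ (MvPolynomial.monomial α 1) = 0) :
    ∃ f, ∀ p, pairing p f = Φ p := by
  classical
  let f : MvPolynomial (Fin r) ℝ := ∑ α ∈ (Finsupp.finite_of_degree_le (σ := Fin r) n).toFinset,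
    MvPolynomial.monomial α (Φ (MvPolynomial.monomial α 1) / ∏ i, ((α i).factorial : ℝ))
  have hcoeff : ∀ α, f.coeff α =
      Φ (MvPolynomial.monomial α 1) / ∏ i, ((α i).factorial : ℝ) := by
    intro α
    simp only [f, MvPolynomial.coeff_sum, MvPolynomial.coeff_monomial, Finset.sum_ite_eq',
      Set.Finite.mem_toFinset, Set.mem_ofPred_eq]
    split_ifs with h
    · rfl
    · rw [hΦ α (not_le.1 h), zero_div]
  refine ⟨f, fun p => ?_⟩
  rw [← pairingHom_apply, p.as_sum, map_sum, map_sum Φ]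
  refine Finset.sum_congr rfl fun α _ => ?_
  rw [← mul_one (p.coeff α), ← smul_eq_mul, ← MvPolynomial.smul_monomial, map_smul, map_smul,
    pairingHom_apply, pairing_monomial_one, hcoeff, mul_div_cancel₀ _ (prod_factorial_ne_zero α)]

end Polynomials

/-- for `𝔅'` with the forward exchange property, `f ↦ ⟨·,f⟩` is an
isomorphism `𝒟(X,𝔅') ≅ 𝒫(X,𝔅')^*`; in particular both dimensions equal `|𝔅'|`. -/
theorem statement10 {r N : ℕ} (X : Fin N → Fin r → ℝ)
    (hX : Submodule.span ℝ (Set.range X) = ⊤)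
    (𝔅' : Set (Finset (Fin N))) (hne : 𝔅'.Nonempty)
    (hsub : 𝔅' ⊆ basesOn X Finset.univ)
    (hfe : forwardExchange X 𝔅') :
    (∃ e : ↥(Dspace X Finset.univ 𝔅') ≃ₗ[ℝ]
        Module.Dual ℝ ↥(PspaceB X Finset.univ 𝔅'),
      ∀ (f : ↥(Dspace X Finset.univ 𝔅')) (p : ↥(PspaceB X Finset.univ 𝔅')),
        e f p = pairing p.1 f.1) ∧
    Module.finrank ℝ ↥(Dspace X Finset.univ 𝔅') = 𝔅'.ncard ∧
    Module.finrank ℝ ↥(PspaceB X Finset.univ 𝔅') = 𝔅'.ncard := by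
  classical
  let := Fintype.ofFinite 𝔅'
  let Q : 𝔅' → MvPolynomial (Fin r) ℝ := fun B => QB X Finset.univ B
  have hPspan : PspaceB X Finset.univ 𝔅' = Submodule.span ℝ (Set.range Q) := by
    rw [PspaceB]
    congr 1
    ext p
    simp [Q, eq_comm]
  have hindep : ∀ a : 𝔅' → ℝ, ∑ B, a B • Q B ∈ Jideal X Finset.univ 𝔅' → a = 0 :=
    fun _ => eq_zero_of_sum_smul_QB_mem_Jideal hsub hfe
  have hQ : LinearIndependent ℝ Q := Fintype.linearIndependent_iff.2 fun a ha =>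
    congrFun (hindep a (ha ▸ zero_mem _))
  have hcompl : IsCompl (PspaceB X Finset.univ 𝔅')
      ((Jideal X Finset.univ 𝔅').restrictScalars ℝ) := by
    refine ⟨Submodule.disjoint_def.2 fun p hp hpJ => ?_,
      codisjoint_iff.2 (PspaceB_sup_Jideal hsub hfe)⟩
    rw [hPspan] at hp
    obtain ⟨a, rfl⟩ := (Submodule.mem_span_range_iff_exists_fun ℝ).1 hp
    simp [hindep a hpJ]
  have hPdim : Module.finrank ℝ ↥(PspaceB X Finset.univ 𝔅') = 𝔅'.ncard := by
    rw [hPspan, finrank_span_eq_card hQ, ← Nat.card_eq_fintype_card, Nat.card_coe_set_eq]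
  let F : ↥(Dspace X Finset.univ 𝔅') →ₗ[ℝ] Module.Dual ℝ ↥(PspaceB X Finset.univ 𝔅') :=
    (LinearMap.lcomp ℝ ℝ (PspaceB X Finset.univ 𝔅').subtype) ∘ₗ pairingHom r ∘ₗ
      (Dspace X Finset.univ 𝔅').subtype
  have hF : ∀ f p, F f p = pairing p.1 f.1 := fun _ _ => rfl
  have hinj : Function.Injective F := by
    refine (injective_iff_map_eq_zero F).2 fun f hf => Subtype.ext ?_
    have hzero : ∀ p, pairing p f.1 = 0 := by
      intro p
      obtain ⟨q, hq, j, hj, rfl⟩ := Submodule.mem_sup.1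
        (show p ∈ PspaceB X Finset.univ 𝔅' ⊔ (Jideal X Finset.univ 𝔅').restrictScalars ℝ from
          hcompl.sup_eq_top ▸ trivial)
      rw [← pairingHom_apply, map_add, pairingHom_apply, pairingHom_apply, f.2 j hj, add_zero,
        ← hF f ⟨q, hq⟩, hf, LinearMap.zero_apply]
    ext α
    have := hzero (MvPolynomial.monomial α 1)
    rw [pairing_monomial_one] at this
    simpa using (mul_eq_zero.1 this).resolve_left (prod_factorial_ne_zero α)
  have hsurj : Function.Surjective F := by
    intro φ
    let Φ : MvPolynomial (Fin r) ℝ →ₗ[ℝ] ℝ := φ ∘ₗ Submodule.projectionOnto _ _ hcompl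
    have hΦJ : ∀ q ∈ Jideal X Finset.univ 𝔅', Φ q = 0 := fun q hq => by
      have : Submodule.projectionOnto _ _ hcompl q = 0 :=
        (Submodule.projectionOnto_apply_eq_zero_iff hcompl).2 hq
      simp [Φ, this]
    obtain ⟨f, hf⟩ := exists_pairing_eq (Φ := Φ) (n := N)
      fun α hα => hΦJ _ (monomial_mem_Jideal hsub hfe hα)
    refine ⟨⟨f, fun q hq => (hf q).trans (hΦJ q hq)⟩, LinearMap.ext fun p => ?_⟩
    rw [hF, hf]
    exact congrArg φ (Submodule.projectionOnto_apply_left hcompl p)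
  let e := LinearEquiv.ofBijective F ⟨hinj, hsurj⟩
  refine ⟨⟨e, hF⟩, ?_, hPdim⟩
  rw [e.finrank_eq, Subspace.dual_finrank_eq, hPdim]
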